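/- (Modulus reduction.) For any integers m, n ≥ 1, q ≥ q' ≥ 1, any (R,δ)-bounded distribution 𝒟 over ℤⁿ, and any α, β > 0 and ε ∈ (0,1/2) such that β² ≥ α² + (4/π)·ln(2n(1+1/ε))·(R/q')², there is a randomized map T : T_qⁿ × T → T_{q'}ⁿ × T, applied independently to each sample, such that every distinguisher f with advantage ζ in distinguishing m samples of A_{q',s,D_{β'(s)}} (with s drawn from 𝒟 and some noise levels β'(s) ≤ β arising from the reduction) from m uniform samples of T_{q'}ⁿ × T yields, by composition with the samplewise application of T, a distinguisher with advantage at least ζ − δ − 14εm for distinguishing m samples of A_{q,s,D_{α(s)}} (s drawn from 𝒟, any noise levels α(s) ≤ α) from m uniform samples of T_qⁿ × T. -/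

import Mathlib

open MeasureTheory ProbabilityTheory

noncomputable section

namespace LWEPaper

/-- The torus `𝕋 = ℝ/ℤ`. -/
abbrev 𝕋 : Type := UnitAddCircle

/-- Embedding of `T_q = {0, 1/q, …, (q−1)/q} ⊆ 𝕋` (represented by `ZMod q`) into `𝕋`,
sending `x mod q` to `x/q mod 1`. -/
noncomputable def toT {q : ℕ} [NeZero q] (x : ZMod q) : 𝕋 := ZMod.toAddCircle x

/-- The continuous Gaussian `D_α` on `ℝ`, with density proportional to `exp (−π x² / α²)`
(for `α > 0`; it is the Gaussian measure with mean `0` and variance `α²/(2π)`). -/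
@[reducible] noncomputable def contGauss (α : ℝ) : Measure ℝ :=
  gaussianReal 0 (α ^ 2 / (2 * Real.pi)).toNNReal

/-- The sample space `T_qⁿ × 𝕋` of the LWE problem, with `T_qⁿ` represented by
`(ZMod q)ⁿ`. -/
abbrev Samp (n q : ℕ) : Type := (Fin n → ZMod q) × 𝕋

/-- The uniform (Haar/Lebesgue) probability distribution on `𝕋`. -/
noncomputable def uniT : Measure 𝕋 := volume

/-- The LWE distribution `A_{q,s,φ}` on `T_qⁿ × 𝕋`: choose `a` uniformly in `T_qⁿ`,
`e` from the error distribution `φ`, and output `(a, ⟨a,s⟩ + e mod 1)`. -/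
noncomputable def lweA (n q : ℕ) [NeZero q] (s : Fin n → ZMod q) (φ : Measure ℝ) :
    Measure (Samp n q) :=
  (((PMF.uniformOfFintype (Fin n → ZMod q)).toMeasure).prod φ).map
    fun ae => (ae.1, toT (∑ j, ae.1 j * s j) + ((ae.2 : ℝ) : 𝕋))

/-- `m` i.i.d. samples from `A_{q,s,φ}` (with the same secret `s` in every sample). -/
noncomputable def lweSamples (n m q : ℕ) [NeZero q] (s : Fin n → ZMod q) (φ : Measure ℝ) :
    Measure (Fin m → Samp n q) :=
  Measure.pi fun _ : Fin m => lweA n q s φ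

/-- The uniform distribution on `T_qⁿ × 𝕋`. -/
noncomputable def uniSamp (n q : ℕ) [NeZero q] : Measure (Samp n q) :=
  ((PMF.uniformOfFintype (Fin n → ZMod q)).toMeasure).prod uniT

/-- `m` i.i.d. uniform samples from `T_qⁿ × 𝕋`. -/
noncomputable def uniSamples (n m q : ℕ) [NeZero q] : Measure (Fin m → Samp n q) :=
  Measure.pi fun _ : Fin m => uniSamp n q

/-- The advantage of a (randomized) distinguisher, described by its acceptance-probability
function `f`, in distinguishing the distributions `P₀` and `P₁`. -/
noncomputable def adv {X : Type*} [MeasurableSpace X] (f : X → ℝ) (P₀ P₁ : Measure X) : ℝ :=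
  |(∫ x, f x ∂P₀) - ∫ x, f x ∂P₁|

/-- A distinguisher: a measurable acceptance-probability function with values in `[0,1]`
(this models an arbitrary, possibly randomized and not necessarily efficient,
`{0,1}`-valued algorithm). -/
def IsDistinguisher {X : Type*} [MeasurableSpace X] (f : X → ℝ) : Prop :=
  Measurable f ∧ ∀ x, f x ∈ Set.Icc (0 : ℝ) 1

/-- Applying a randomized transformation (Markov kernel) `κ` independently to each of the
`m` samples. -/
noncomputable def samplewise {S S' : Type*} [MeasurableSpace S] [MeasurableSpace S'] (m : ℕ)
    (κ : Kernel S S') (x : Fin m → S) : Measure (Fin m → S') :=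
  Measure.pi fun i => κ (x i)

/-- Euclidean norm of an integer vector. -/
noncomputable def inorm {n : ℕ} (s : Fin n → ℤ) : ℝ := Real.sqrt (∑ i, ((s i : ℝ)) ^ 2)

/-- Reduction of an integer vector modulo `q`. -/
def modq {n : ℕ} (q : ℕ) (s : Fin n → ℤ) : Fin n → ZMod q := fun i => ((s i : ℤ) : ZMod q)

/-- The statistical distance between two measures: the supremum, over measurable events,
of the discrepancy of the two measures (for probability measures this equals half the
total variation of their difference). -/
noncomputable def statDist {Ω : Type*} [MeasurableSpace Ω] (μ ν : Measure Ω) : ℝ :=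
  ⨆ A : { s : Set Ω // MeasurableSet s }, |(μ A).toReal - (ν A).toReal|

/-- A distribution `𝒟` on `ℤⁿ` is `(R,δ)`-bounded if the probability that a vector drawn
from `𝒟` has euclidean norm greater than `R` is at most `δ`. -/
def IsBounded {n : ℕ} (𝒟 : PMF (Fin n → ℤ)) (R δ : ℝ) : Prop :=
  (𝒟.toMeasure {x | R < inorm x}).toReal ≤ δ

lemma theta_bound {w : ℝ} (hw : 0 < w) (c : ℝ) :
    Summable (fun n : ℤ => Real.exp (-Real.pi * (n + c) ^ 2 / w ^ 2)) ∧
    |∑' n : ℤ, Real.exp (-Real.pi * (n + c) ^ 2 / w ^ 2) - w| ≤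
      w * (2 * Real.exp (-Real.pi * w ^ 2) / (1 - Real.exp (-Real.pi * w ^ 2))) := by
  set x := Real.exp (-Real.pi * w ^ 2) with hx
  have hx0 : 0 < x := Real.exp_pos _
  have hx1 : x < 1 := by
    rw [hx, Real.exp_lt_one_iff]
    have := Real.pi_pos
    have : 0 < Real.pi * w ^ 2 := by positivity
    linarith
  have ha : 0 < ((w ^ 2 : ℝ) : ℂ).re := by
    rw [Complex.ofReal_re]
    positivity
  have key := Complex.tsum_exp_neg_quadratic ha (-Complex.I * c)
  have hroot : (((w ^ 2 : ℝ) : ℂ)) ^ (1 / 2 : ℂ) = (w : ℂ) := by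
    rw [show (1 / 2 : ℂ) = ((1 / 2 : ℝ) : ℂ) by norm_num, ← Complex.ofReal_cpow (by positivity),
      ← Real.sqrt_eq_rpow, Real.sqrt_sq hw.le]
  have hR : (∑' n : ℤ, Complex.exp (-Real.pi / ((w ^ 2 : ℝ) : ℂ) *
      (n + Complex.I * (-Complex.I * c)) ^ 2)) =
      ((∑' n : ℤ, Real.exp (-Real.pi * (n + c) ^ 2 / w ^ 2) : ℝ) : ℂ) := by
    rw [Complex.ofReal_tsum]
    refine tsum_congr fun n => ?_
    rw [show Complex.I * (-Complex.I * c) = c by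
      rw [← mul_assoc, mul_neg, Complex.I_mul_I]; simp]
    push_cast
    congr 1
    ring
  rw [hR, hroot] at key
  set F : ℤ → ℂ := fun n => Complex.exp (-Real.pi * ((w ^ 2 : ℝ) : ℂ) * n ^ 2 +
    2 * Real.pi * (-Complex.I * c) * n) with hF
  have hFn (n : ℤ) : ‖F n‖ ≤ x ^ n.natAbs := by
    rw [hF, Complex.norm_exp, hx, ← Real.exp_nat_mul]
    apply Real.exp_le_exp.mpr
    have e1 : (-Real.pi * ((w ^ 2 : ℝ) : ℂ) * n ^ 2 + 2 * Real.pi * (-Complex.I * c) * n) =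
      ((-Real.pi * w ^ 2 * n ^ 2 : ℝ) : ℂ) + ((-2 * Real.pi * c * n : ℝ) : ℂ) * Complex.I := by
      push_cast; ring
    rw [e1, Complex.add_re, Complex.ofReal_re, Complex.re_ofReal_mul, Complex.I_re, mul_zero,
      add_zero]
    have h2 : (n.natAbs : ℝ) ≤ (n : ℝ) ^ 2 := by
      have : (n.natAbs : ℝ) = |(n : ℝ)| := by simp [Nat.cast_natAbs]
      rw [this]
      have h : |n| ≤ n ^ 2 := by
        rw [← Int.natCast_natAbs]
        exact Int.natAbs_le_self_sq n
      exact_mod_cast h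
    have : 0 < Real.pi * w ^ 2 := by have := Real.pi_pos; positivity
    nlinarith
  have hu : HasSum (fun n : ℤ => if n = 0 then 0 else x ^ n.natAbs) (x / (1 - x) + x / (1 - x)) := by
    have hg : HasSum (fun n : ℕ => x ^ (n + 1)) (x / (1 - x)) := by
      simpa [pow_succ', div_eq_mul_inv] using (hasSum_geometric_of_lt_one hx0.le hx1).mul_left x
    refine HasSum.of_nat_of_neg_add_one ?_ ?_
    · rw [← hasSum_nat_add_iff' 1]
      have h0 : (∑ i ∈ Finset.range 1, if (i : ℤ) = 0 then 0 else x ^ (i : ℤ).natAbs) = 0 := by simp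
      rw [h0, sub_zero]
      refine hg.congr_fun fun n => ?_
      rw [if_neg (by omega), Int.natAbs_natCast]
    · refine hg.congr_fun fun n => ?_
      have : (-((n : ℤ) + 1)).natAbs = n + 1 := by omega
      rw [this, if_neg (by omega)]
  have hF0 : F 0 = 1 := by simp [hF]
  have hsumF : Summable F := by
    refine Summable.of_norm_bounded_eventually hu.summable ?_
    rw [Filter.eventually_cofinite]
    refine (Set.finite_singleton (0 : ℤ)).subset fun n hn => ?_
    by_contra h
    simp only [Set.mem_singleton_iff] at h
    exact hn (by simpa [h] using hFn n)
  have hFb : ‖(∑' n, F n) - 1‖ ≤ x / (1 - x) + x / (1 - x) := by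
    have h1 : (∑' n, F n) - 1 = ∑' n : ℤ, (F n - if n = 0 then 1 else 0) := by
      rw [hsumF.tsum_sub (summable_of_ne_finset_zero (s := {0}) (by simp_all)), tsum_ite_eq]
    rw [h1]
    refine tsum_of_norm_bounded hu fun n => ?_
    by_cases h : n = 0
    · simp [h, hF0]
    · simpa [h] using hFn n
  have hw' : (w : ℂ) ≠ 0 := by exact_mod_cast hw.ne'
  constructor
  · have h1 := ((summable_jacobiTheta₂_term_iff (Complex.I * (c / w ^ 2 : ℝ))
      (Complex.I * (1 / w ^ 2 : ℝ))).mpr (by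
        rw [Complex.I_mul_im, Complex.ofReal_re]; positivity)).norm
    refine (h1.mul_left (Real.exp (-Real.pi * c ^ 2 / w ^ 2))).congr fun n => ?_
    rw [norm_jacobiTheta₂_term, Complex.I_mul_im, Complex.I_mul_im, Complex.ofReal_re,
      Complex.ofReal_re, ← Real.exp_add]
    congr 1
    field_simp
    ring
  · set S := ∑' n : ℤ, Real.exp (-Real.pi * (n + c) ^ 2 / w ^ 2)
    have : ((S - w : ℝ) : ℂ) = w * ((∑' n, F n) - 1) := by
      rw [key]; push_cast; field_simp
    rw [← Real.norm_eq_abs, ← Complex.norm_real, this, norm_mul, Complex.norm_real,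
      Real.norm_of_nonneg hw.le]
    refine mul_le_mul_of_nonneg_left (hFb.trans_eq (by ring)) hw.le

lemma smul_pi_le_pi {ι : Type*} [Fintype ι] {X : ι → Type*} [∀ i, MeasurableSpace (X i)]
    {μ ν : ∀ i, Measure (X i)} [∀ i, SigmaFinite (μ i)] [∀ i, SigmaFinite (ν i)] {c : ENNReal}
    (h : ∀ i, c • ν i ≤ μ i) :
    c ^ Fintype.card ι • Measure.pi ν ≤ Measure.pi μ := by
  have h1 : (c ^ Fintype.card ι • Measure.pi ν).toOuterMeasure ≤
      OuterMeasure.pi fun i => (μ i).toOuterMeasure := by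
    rw [OuterMeasure.le_pi]
    intro s _
    simp only [Measure.coe_toOuterMeasure, Measure.smul_apply, Measure.pi_pi, smul_eq_mul]
    rw [← Finset.card_univ, ← Finset.prod_const, ← Finset.prod_mul_distrib]
    exact Finset.prod_le_prod' fun i _ => h i (s i)
  exact Measure.le_intro fun s hs _ => by
    refine (h1 s).trans ?_
    rw [Measure.pi]
    exact le_toMeasure_apply _ _ s

lemma lintegral_pi_prod {ι : Type*} [Fintype ι] {X : ι → Type*} [∀ i, MeasurableSpace (X i)]
    (μ : ∀ i, Measure (X i)) [∀ i, IsProbabilityMeasure (μ i)] {f : ∀ i, X i → ENNReal}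
    (hf : ∀ i, Measurable (f i)) :
    ∫⁻ x, ∏ i, f i (x i) ∂Measure.pi μ = ∏ i, ∫⁻ x, f i x ∂μ i := by
  rw [lintegral_prod_eq_prod_lintegral_of_indepFun Finset.univ (fun i (x : ∀ i, X i) => f i (x i))
    (iIndepFun_pi fun i => (hf i).aemeasurable) fun i => (hf i).comp (measurable_pi_apply i)]
  exact Finset.prod_congr rfl fun i _ =>
    (measurePreserving_eval μ i).lintegral_comp (hf i)

lemma measurable_samplewise {S S' : Type*} [MeasurableSpace S] [MeasurableSpace S'] (m : ℕ)
    (κ : Kernel S S') [IsMarkovKernel κ] : Measurable (samplewise m κ) := by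
  have (x : Fin m → S) : IsProbabilityMeasure (samplewise m κ x) := by
    unfold samplewise; infer_instance
  refine .measure_of_isPiSystem_of_isProbabilityMeasure generateFrom_pi.symm isPiSystem_pi ?_
  rintro _ ⟨s, hs, rfl⟩
  simp only [samplewise, Measure.pi_pi]
  exact Finset.measurable_prod _ fun i _ =>
    (κ.measurable_coe (hs i (Set.mem_univ i))).comp (measurable_pi_apply i)

lemma pi_bind_samplewise {S S' : Type*} [MeasurableSpace S] [MeasurableSpace S'] (m : ℕ)
    (κ : Kernel S S') [IsMarkovKernel κ] (μ : Measure S) [IsProbabilityMeasure μ] :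
    (Measure.pi fun _ : Fin m => μ).bind (samplewise m κ) =
      Measure.pi fun _ : Fin m => μ.bind κ := by
  refine (Measure.pi_eq fun s hs => ?_).symm
  rw [Measure.bind_apply (.univ_pi hs) (measurable_samplewise m κ).aemeasurable]
  simp only [samplewise, Measure.pi_pi]
  rw [lintegral_pi_prod _ fun i => κ.measurable_coe (hs i)]
  exact Finset.prod_congr rfl fun i _ => (Measure.bind_apply (hs i) κ.aemeasurable).symm

lemma uniformOfFintype_pi (n q : ℕ) [NeZero q] :
    (PMF.uniformOfFintype (Fin n → ZMod q)).toMeasure =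
      Measure.pi fun _ : Fin n => (PMF.uniformOfFintype (ZMod q)).toMeasure := by
  refine Measure.ext_of_singleton fun a => ?_
  rw [PMF.toMeasure_apply_singleton _ _ (measurableSet_singleton a), Measure.pi_singleton]
  simp only [PMF.toMeasure_apply_singleton _ _ (measurableSet_singleton _),
    PMF.uniformOfFintype_apply, Finset.prod_const, Finset.card_univ, Fintype.card_pi,
    Fintype.card_fin, Nat.cast_pow, ENNReal.inv_pow]

lemma contGauss_conv {α β γ : ℝ} (h : γ ^ 2 = α ^ 2 + β ^ 2) :
    ((contGauss α).prod (contGauss β)).map (fun p => p.1 + p.2) = contGauss γ := by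
  change (contGauss α) ∗ (contGauss β) = _
  rw [contGauss, contGauss, gaussianReal_conv_gaussianReal, add_zero, ← Real.toNNReal_add
    (by positivity) (by positivity), contGauss, h, add_div]

lemma pi_contGauss_map_sum {n : ℕ} (r : ℝ) (c : Fin n → ℝ) :
    (Measure.pi fun _ : Fin n => contGauss r).map (fun g => ∑ i, c i * g i) =
      contGauss (r * Real.sqrt (∑ i, c i ^ 2)) := by
  refine Measure.ext_of_charFun ?_
  ext t
  rw [charFun_gaussianReal, charFun_apply_real, integral_map
    (Finset.measurable_sum _ fun i _ => by fun_prop).aemeasurable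
    (by fun_prop)]
  have h1 (g : Fin n → ℝ) : Complex.exp (t * ((∑ i, c i * g i : ℝ) : ℂ) * Complex.I) =
      ∏ i, Complex.exp (((t * c i : ℝ) : ℂ) * g i * Complex.I) := by
    rw [← Complex.exp_sum]
    push_cast
    rw [Finset.mul_sum, Finset.sum_mul]
    congr 1
    exact Finset.sum_congr rfl fun i _ => by ring
  simp_rw [h1]
  rw [integral_fintype_prod_eq_prod
    (f := fun i (x : ℝ) => Complex.exp (((t * c i : ℝ) : ℂ) * x * Complex.I))]
  simp_rw [← charFun_apply_real, charFun_gaussianReal]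
  rw [← Complex.exp_sum]
  congr 1
  rw [Real.coe_toNNReal _ (by positivity), Real.coe_toNNReal _ (by positivity), mul_pow,
    Real.sq_sqrt (Finset.sum_nonneg fun i _ => sq_nonneg _)]
  push_cast
  simp only [mul_zero, zero_mul, zero_sub]
  rw [Finset.sum_neg_distrib, Finset.mul_sum, Finset.sum_div, Finset.sum_mul, Finset.sum_div]
  congr 1
  exact Finset.sum_congr rfl fun i _ => by ring

/-- The density of the continuous Gaussian `D_r`. -/
def gaussDens (r x : ℝ) : ℝ := Real.exp (-Real.pi * x ^ 2 / r ^ 2) / r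

@[fun_prop]
lemma measurable_gaussDens (r : ℝ) : Measurable (gaussDens r) := by
  unfold gaussDens; fun_prop

lemma contGauss_eq_withDensity {r : ℝ} (hr : 0 < r) :
    contGauss r = volume.withDensity fun x => ENNReal.ofReal (gaussDens r x) := by
  have hpi := Real.pi_pos
  have h0 : 0 < r ^ 2 / (2 * Real.pi) := by positivity
  rw [contGauss, gaussianReal_of_var_ne_zero _ (by simpa using h0)]
  congr 1
  ext x
  rw [gaussianPDF, gaussianPDFReal, Real.coe_toNNReal _ h0.le, gaussDens]
  congr 1
  have e1 : 2 * Real.pi * (r ^ 2 / (2 * Real.pi)) = r ^ 2 := by field_simp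
  rw [e1, Real.sqrt_sq hr.le, sub_zero,
    show -x ^ 2 / (2 * (r ^ 2 / (2 * Real.pi))) = -Real.pi * x ^ 2 / r ^ 2 by field_simp]
  exact inv_mul_eq_div _ _

lemma lintegral_contGauss_add {r : ℝ} (hr : 0 < r) (f : ℝ) {G : ℝ → ENNReal}
    (hG : Measurable G) :
    ∫⁻ g, G (f + g) ∂contGauss r = ∫⁻ h, ENNReal.ofReal (gaussDens r (h - f)) * G h := by
  rw [contGauss_eq_withDensity hr,
    lintegral_withDensity_eq_lintegral_mul _ (by fun_prop) (by fun_prop),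
    ← lintegral_add_left_eq_self (fun h => ENNReal.ofReal (gaussDens r (h - f)) * G h) f]
  simp

/-- The real number `k/q' - a/q`, where `a` is represented in `{0, …, q-1}`. -/
def offset {q : ℕ} (q' : ℕ) (a : ZMod q) (k : ℤ) : ℝ := k / q' - a.val / q

lemma offset_sq_div {q : ℕ} (q' : ℕ) [NeZero q'] {r : ℝ} (hr : 0 < r) (a : ZMod q) (k : ℤ) :
    -Real.pi * offset q' a k ^ 2 / r ^ 2 =
      -Real.pi * (k + (-(a.val * q' / q : ℝ))) ^ 2 / (r * q') ^ 2 := by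
  have : (q' : ℝ) ≠ 0 := by exact_mod_cast NeZero.ne q'
  rw [offset]
  field_simp
  ring

lemma summable_offset {q : ℕ} (q' : ℕ) [NeZero q'] {r : ℝ} (hr : 0 < r) (a : ZMod q) :
    Summable fun k => Real.exp (-Real.pi * offset q' a k ^ 2 / r ^ 2) := by
  have : (0 : ℝ) < q' := by exact_mod_cast NeZero.pos q'
  simp_rw [offset_sq_div q' hr a]
  exact (theta_bound (mul_pos hr this) _).1

/-- The discrete Gaussian distribution of width `r` on the coset `(1/q')ℤ - a/q`, as a distribution
of the integer `k` such that the sampled point is `k/q' - a/q`. -/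
def roundPMF {q : ℕ} (q' : ℕ) [NeZero q'] {r : ℝ} (hr : 0 < r) (a : ZMod q) : PMF ℤ :=
  PMF.normalize (fun k => ENNReal.ofReal (Real.exp (-Real.pi * offset q' a k ^ 2 / r ^ 2)))
    (fun h => by
      have := ENNReal.ofReal_eq_zero.mp (ENNReal.tsum_eq_zero.mp h 0)
      exact (Real.exp_pos _).not_ge this)
    (by
      rw [← ENNReal.ofReal_tsum_of_nonneg (fun _ => (Real.exp_pos _).le)
        (summable_offset q' hr a)]
      exact ENNReal.ofReal_ne_top)

/-- The joint law of `k mod q'` and `k/q' - a/q + g`, for `k` sampled from `roundPMF` and `g` an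
independent continuous Gaussian. -/
def roundJoint {q : ℕ} (q' : ℕ) [NeZero q'] {r : ℝ} (hr : 0 < r) (a : ZMod q) :
    Measure (ZMod q' × ℝ) :=
  ((roundPMF q' hr a).toMeasure.prod (contGauss r)).map
    fun p => ((p.1 : ZMod q'), offset q' a p.1 + p.2)

instance {q : ℕ} (q' : ℕ) [NeZero q'] {r : ℝ} (hr : 0 < r) (a : ZMod q) :
    IsProbabilityMeasure (roundJoint q' hr a) :=
  Measure.isProbabilityMeasure_map (by unfold offset; fun_prop)

lemma lintegral_roundJoint {q : ℕ} (q' : ℕ) [NeZero q'] {r : ℝ} (hr : 0 < r) (a : ZMod q)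
    {F : ZMod q' × ℝ → ENNReal} (hF : Measurable F) :
    ∫⁻ x, F x ∂roundJoint q' hr a = ∑' k : ℤ, roundPMF q' hr a k *
      ∫⁻ h, ENNReal.ofReal (gaussDens r (h - offset q' a k)) * F (k, h) := by
  have hm : Measurable fun p : ℤ × ℝ => ((p.1 : ZMod q'), offset q' a p.1 + p.2) := by
    unfold offset; fun_prop
  rw [roundJoint, lintegral_map hF hm, lintegral_prod _ (by exact (hF.comp hm).aemeasurable),
    lintegral_countable']
  refine tsum_congr fun k => ?_
  rw [PMF.toMeasure_apply_singleton _ _ (measurableSet_singleton k), mul_comm]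
  congr 1
  exact lintegral_contGauss_add hr (offset q' a k) (G := fun h => F (k, h)) (by fun_prop)

lemma tsum_gaussDens_ge {q : ℕ} [NeZero q] {r η : ℝ} (hr : 0 < r)
    (h2 : ∀ c : ℝ, (1 - η) * (r * q / Real.sqrt 2) ≤
      ∑' n : ℤ, Real.exp (-Real.pi * (n + c) ^ 2 / (r * q / Real.sqrt 2) ^ 2)) (x h : ℝ) :
    ENNReal.ofReal ((1 - η) * q * r * gaussDens (Real.sqrt 2 * r) h) ≤
      ∑' j : ℤ, ENNReal.ofReal (Real.exp (-Real.pi * (x - j / q) ^ 2 / r ^ 2)) *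
        ENNReal.ofReal (gaussDens r (h - (x - j / q))) := by
  have hq : (0 : ℝ) < q := by exact_mod_cast NeZero.pos q
  have hs : (0 : ℝ) < Real.sqrt 2 := by positivity
  have hs2 : Real.sqrt 2 ^ 2 = 2 := Real.sq_sqrt (by norm_num)
  set c : ℝ := q * (h / 2 - x) with hc
  have key (j : ℤ) : Real.exp (-Real.pi * (x - j / q) ^ 2 / r ^ 2) * gaussDens r (h - (x - j / q)) =
      Real.exp (-Real.pi * h ^ 2 / (2 * r ^ 2)) / r *
        Real.exp (-Real.pi * (j + c) ^ 2 / (r * q / Real.sqrt 2) ^ 2) := by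
    rw [gaussDens, div_mul_eq_mul_div, ← Real.exp_add, mul_div_assoc', ← Real.exp_add]
    congr 2
    rw [div_pow, mul_pow, hs2, hc]
    field_simp
    ring
  simp_rw [← ENNReal.ofReal_mul (Real.exp_pos _).le, key]
  rw [← ENNReal.ofReal_tsum_of_nonneg (fun _ => by positivity)
    ((theta_bound (by positivity) c).1.mul_left _), tsum_mul_left]
  apply ENNReal.ofReal_le_ofReal
  refine le_trans (le_of_eq ?_) (mul_le_mul_of_nonneg_left (h2 c) (by positivity))
  rw [gaussDens, mul_pow, hs2]
  field_simp

/-- The reindexing of pairs `(b, j)` with `b mod q'` as pairs `(a, k)` with `a mod q`, such that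
`k/q' - a/q = b/q' - j/q`. -/
def swapCoset (q q' : ℕ) (p : ZMod q' × ℤ) : ZMod q × ℤ :=
  ((p.2 : ZMod q), p.1.val - q' * (p.2 / q))

lemma swapCoset_snd_cast (q q' : ℕ) [NeZero q'] (p : ZMod q' × ℤ) :
    ((swapCoset q q' p).2 : ZMod q') = p.1 := by
  simp [swapCoset]

lemma swapCoset_injective (q q' : ℕ) [NeZero q] [NeZero q'] :
    Function.Injective (swapCoset q q') := by
  rintro ⟨b, j⟩ ⟨b', j'⟩ h
  obtain rfl : b = b' := by
    simpa [swapCoset_snd_cast] using congrArg (fun p : ZMod q × ℤ => (p.2 : ZMod q')) h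
  simp only [swapCoset, Prod.mk.injEq, sub_right_inj, mul_eq_mul_left_iff, Nat.cast_eq_zero,
    NeZero.ne q', or_false] at h
  have h1 : j % q = j' % q := (ZMod.intCast_eq_intCast_iff' _ _ _).mp h.1
  have : j = j' := by rw [← Int.emod_add_mul_ediv j q, ← Int.emod_add_mul_ediv j' q, h1, h.2]
  rw [this]

lemma offset_swapCoset (q q' : ℕ) [NeZero q] [NeZero q'] (p : ZMod q' × ℤ) :
    offset q' (swapCoset q q' p).1 (swapCoset q q' p).2 = p.1.val / q' - p.2 / q := by
  have hq : (q : ℝ) ≠ 0 := by exact_mod_cast NeZero.ne q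
  have hq' : (q' : ℝ) ≠ 0 := by exact_mod_cast NeZero.ne q'
  have h1 : (((p.2 : ZMod q).val : ℤ) : ℝ) = (p.2 : ℝ) - q * ((p.2 / q : ℤ) : ℝ) := by
    rw [ZMod.val_intCast, Int.emod_def]
    push_cast
    rfl
  rw [Int.cast_natCast] at h1
  simp only [offset, swapCoset]
  rw [h1]
  push_cast
  field_simp
  ring

lemma smul_le_bind_roundJoint (q q' : ℕ) [NeZero q] [NeZero q'] {r η : ℝ} (hr : 0 < r)
    (hη : 0 < η) (hη1 : η ≤ 1)
    (h1 : ∀ c : ℝ, ∑' n : ℤ, Real.exp (-Real.pi * (n + c) ^ 2 / (r * q') ^ 2) ≤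
      (1 + η) * (r * q'))
    (h2 : ∀ c : ℝ, (1 - η) * (r * q / Real.sqrt 2) ≤
      ∑' n : ℤ, Real.exp (-Real.pi * (n + c) ^ 2 / (r * q / Real.sqrt 2) ^ 2)) :
    ENNReal.ofReal ((1 - η) / (1 + η)) •
      (PMF.uniformOfFintype (ZMod q')).toMeasure.prod (contGauss (Real.sqrt 2 * r)) ≤
    (PMF.uniformOfFintype (ZMod q)).toMeasure.bind (roundJoint q' hr) := by
  have hq : (0 : ℝ) < q := by exact_mod_cast NeZero.pos q
  have hq' : (0 : ℝ) < q' := by exact_mod_cast NeZero.pos q'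
  have hsr : 0 < Real.sqrt 2 * r := by positivity
  suffices H : ∀ F : ZMod q' × ℝ → ENNReal, Measurable F →
      ENNReal.ofReal ((1 - η) / (1 + η)) * ∫⁻ x, F x ∂(PMF.uniformOfFintype (ZMod q')).toMeasure.prod
        (contGauss (Real.sqrt 2 * r)) ≤
      ∫⁻ x, F x ∂(PMF.uniformOfFintype (ZMod q)).toMeasure.bind (roundJoint q' hr) by
    refine Measure.le_intro fun s hs _ => ?_
    simpa [lintegral_indicator_one hs] using H (s.indicator 1) (measurable_one.indicator hs)
  intro F hF
  set Z : ENNReal := ENNReal.ofReal (((1 + η) * (r * q'))⁻¹) with hZ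
  have hround (a : ZMod q) (k : ℤ) :
      ENNReal.ofReal (Real.exp (-Real.pi * offset q' a k ^ 2 / r ^ 2)) * Z ≤ roundPMF q' hr a k := by
    rw [roundPMF, PMF.normalize_apply]
    gcongr
    rw [hZ, ENNReal.ofReal_inv_of_pos (by positivity), ENNReal.inv_le_inv,
      ← ENNReal.ofReal_tsum_of_nonneg (fun _ => (Real.exp_pos _).le) (summable_offset q' hr a)]
    apply ENNReal.ofReal_le_ofReal
    simp_rw [offset_sq_div q' hr a]
    exact h1 _
  set Φ : ZMod q × ℤ → ENNReal := fun p =>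
    (q : ENNReal)⁻¹ * (ENNReal.ofReal (Real.exp (-Real.pi * offset q' p.1 p.2 ^ 2 / r ^ 2)) * Z *
      ∫⁻ h, ENNReal.ofReal (gaussDens r (h - offset q' p.1 p.2)) * F (p.2, h)) with hΦ
  calc ENNReal.ofReal ((1 - η) / (1 + η)) * ∫⁻ x, F x ∂(PMF.uniformOfFintype (ZMod q')).toMeasure.prod
        (contGauss (Real.sqrt 2 * r))
      = ∑ b : ZMod q', ∫⁻ h, (q : ENNReal)⁻¹ * Z *
          ENNReal.ofReal ((1 - η) * q * r * gaussDens (Real.sqrt 2 * r) h) * F (b, h) := by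
        rw [lintegral_prod _ hF.aemeasurable, lintegral_fintype, Finset.mul_sum]
        refine Finset.sum_congr rfl fun b _ => ?_
        rw [PMF.toMeasure_apply_singleton _ _ (measurableSet_singleton b),
          PMF.uniformOfFintype_apply, ZMod.card]
        have e1 := lintegral_contGauss_add hsr 0 (G := fun h => F (b, h)) (by fun_prop)
        simp only [zero_add, sub_zero] at e1
        rw [e1, ← lintegral_mul_const _ (by fun_prop), ← lintegral_const_mul _ (by fun_prop)]
        refine lintegral_congr fun h => ?_
        have hg : 0 ≤ gaussDens (Real.sqrt 2 * r) h := by unfold gaussDens; positivity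
        have e2 : ENNReal.ofReal ((1 - η) / (1 + η)) * (q' : ENNReal)⁻¹ *
            ENNReal.ofReal (gaussDens (Real.sqrt 2 * r) h) = (q : ENNReal)⁻¹ * Z *
            ENNReal.ofReal ((1 - η) * q * r * gaussDens (Real.sqrt 2 * r) h) := by
          rw [hZ, ← ENNReal.ofReal_natCast q, ← ENNReal.ofReal_natCast q',
            ← ENNReal.ofReal_inv_of_pos hq, ← ENNReal.ofReal_inv_of_pos hq',
            ← ENNReal.ofReal_mul (div_nonneg (by linarith) (by linarith)),
            ← ENNReal.ofReal_mul (mul_nonneg (div_nonneg (by linarith) (by linarith))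
              (by positivity)),
            ← ENNReal.ofReal_mul (by positivity), ← ENNReal.ofReal_mul (by positivity)]
          congr 1
          field_simp
        rw [← e2]
        ring
    _ ≤ ∑ b : ZMod q', ∑' j : ℤ, Φ (swapCoset q q' (b, j)) := by
        refine Finset.sum_le_sum fun b _ => ?_
        have e1 (j : ℤ) : Φ (swapCoset q q' (b, j)) = ∫⁻ h, (q : ENNReal)⁻¹ * Z *
            (ENNReal.ofReal (Real.exp (-Real.pi * (b.val / q' - j / q) ^ 2 / r ^ 2)) *
            ENNReal.ofReal (gaussDens r (h - (b.val / q' - j / q)))) * F (b, h) := by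
          simp only [hΦ, offset_swapCoset, swapCoset_snd_cast]
          rw [← lintegral_const_mul _ (by fun_prop), ← lintegral_const_mul _ (by fun_prop)]
          exact lintegral_congr fun h => by ring
        simp_rw [e1]
        rw [← lintegral_tsum fun j => Measurable.aemeasurable (by fun_prop)]
        refine lintegral_mono fun h => ?_
        rw [ENNReal.tsum_mul_right, ENNReal.tsum_mul_left]
        gcongr
        exact tsum_gaussDens_ge hr h2 _ h
    _ = ∑' p : ZMod q' × ℤ, Φ (swapCoset q q' p) := by
        rw [ENNReal.tsum_prod', tsum_fintype]
    _ ≤ ∑' p : ZMod q × ℤ, Φ p :=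
        ENNReal.tsum_comp_le_tsum_of_injective (swapCoset_injective q q') Φ
    _ = ∑ a : ZMod q, ∑' k : ℤ, Φ (a, k) := by
        rw [ENNReal.tsum_prod', tsum_fintype]
    _ ≤ ∫⁻ x, F x ∂(PMF.uniformOfFintype (ZMod q)).toMeasure.bind (roundJoint q' hr) := by
        rw [Measure.lintegral_bind measurable_from_top.aemeasurable hF.aemeasurable,
          lintegral_fintype]
        refine Finset.sum_le_sum fun a _ => ?_
        rw [PMF.toMeasure_apply_singleton _ _ (measurableSet_singleton a),
          PMF.uniformOfFintype_apply, ZMod.card, lintegral_roundJoint q' hr a hF, mul_comm,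
          ENNReal.tsum_mul_left]
        gcongr with k
        exact hround a k

lemma toT_sum_intCast {n q : ℕ} [NeZero q] (k s : Fin n → ℤ) :
    toT (∑ j, modq q k j * modq q s j) = ((∑ j, (k j : ℝ) * s j / q : ℝ) : 𝕋) := by
  have : ∑ j, modq q k j * modq q s j = ((∑ j, k j * s j : ℤ) : ZMod q) := by
    simp [modq]
  rw [this, toT, ZMod.toAddCircle_intCast]
  push_cast
  rw [Finset.sum_div]

lemma toT_sum_val {n q : ℕ} [NeZero q] (a : Fin n → ZMod q) (s : Fin n → ℤ) :
    toT (∑ j, a j * modq q s j) = ((∑ j, ((a j).val : ℝ) * s j / q : ℝ) : 𝕋) := by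
  have h := toT_sum_intCast (q := q) (fun j => ((a j).val : ℤ)) s
  simpa [modq] using h

/-- The analogue of `lweA` with the error distribution given directly on the torus. -/
def lweTorus (n q : ℕ) [NeZero q] (s : Fin n → ZMod q) (ν : Measure 𝕋) : Measure (Samp n q) :=
  ((PMF.uniformOfFintype (Fin n → ZMod q)).toMeasure.prod ν).map
    fun p => (p.1, toT (∑ j, p.1 j * s j) + p.2)

lemma measurable_toT_sum (n q : ℕ) [NeZero q] (s : Fin n → ZMod q) :
    Measurable fun a : Fin n → ZMod q => toT (∑ j, a j * s j) := .of_discrete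

lemma measurable_lweTorus_map (n q : ℕ) [NeZero q] (s : Fin n → ZMod q) :
    Measurable fun p : (Fin n → ZMod q) × 𝕋 => (p.1, toT (∑ j, p.1 j * s j) + p.2) :=
  measurable_fst.prodMk (((measurable_toT_sum n q s).comp measurable_fst).add measurable_snd)

instance (n q : ℕ) [NeZero q] (s : Fin n → ZMod q) (ν : Measure 𝕋) [IsProbabilityMeasure ν] :
    IsProbabilityMeasure (lweTorus n q s ν) :=
  Measure.isProbabilityMeasure_map (measurable_lweTorus_map n q s).aemeasurable

lemma lintegral_lweTorus (n q : ℕ) [NeZero q] (s : Fin n → ZMod q) (ν : Measure 𝕋)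
    [IsProbabilityMeasure ν] {F : Samp n q → ENNReal} (hF : Measurable F) :
    ∫⁻ x, F x ∂lweTorus n q s ν = ∫⁻ x, ∫⁻ a, F (a, toT (∑ j, a j * s j) + x)
      ∂(PMF.uniformOfFintype (Fin n → ZMod q)).toMeasure ∂ν := by
  have h := hF.comp (measurable_lweTorus_map n q s)
  rw [lweTorus, lintegral_map hF (measurable_lweTorus_map n q s)]
  exact lintegral_prod_symm _ h.aemeasurable

lemma measurable_coe_torus : Measurable fun x : ℝ => (x : 𝕋) :=
  (AddCircle.continuous_mk' 1).measurable

lemma measurable_modq (n q : ℕ) : Measurable (modq (n := n) q) := .of_discrete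

/-- The modulus reduction: the first component is rounded by discrete Gaussians of width `r`, and a
Gaussian of width `r * R` is added to the second component. -/
def reduction (n q q' : ℕ) [NeZero q] [NeZero q'] {r : ℝ} (hr : 0 < r) (R : ℝ) :
    Kernel (Samp n q) (Samp n q') where
  toFun x := ((Measure.pi fun i => (roundPMF q' hr (x.1 i)).toMeasure).prod
    (contGauss (r * R))).map fun p => (modq q' p.1, x.2 + (p.2 : 𝕋))
  measurable' := by
    refine measurable_from_prod_countable_right fun a => ?_
    have hg : Measurable fun p : 𝕋 × (Fin n → ℤ) × ℝ => (modq q' p.2.1, p.1 + (p.2.2 : 𝕋)) :=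
      ((measurable_modq n q').comp (measurable_fst.comp measurable_snd)).prodMk
        (measurable_fst.add (measurable_coe_torus.comp (measurable_snd.comp measurable_snd)))
    have h := (Measure.measurable_map _ hg).comp (Measurable.map_prodMk_left
      (ν := (Measure.pi fun i => (roundPMF q' hr (a i)).toMeasure).prod (contGauss (r * R))))
    convert h using 2 with b
    exact (Measure.map_map hg measurable_prodMk_left).symm

lemma measurable_reduction_map (n q' : ℕ) (b : 𝕋) :
    Measurable fun p : (Fin n → ℤ) × ℝ => (modq q' p.1, b + (p.2 : 𝕋)) :=
  ((measurable_modq n q').comp measurable_fst).prodMk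
    ((measurable_coe_torus.comp measurable_snd).const_add b)

instance (n q q' : ℕ) [NeZero q] [NeZero q'] {r : ℝ} (hr : 0 < r) (R : ℝ) :
    IsMarkovKernel (reduction n q q' hr R) :=
  ⟨fun x => Measure.isProbabilityMeasure_map (measurable_reduction_map n q' x.2).aemeasurable⟩

lemma lintegral_reduction (n q q' : ℕ) [NeZero q] [NeZero q'] {r : ℝ} (hr : 0 < r) (R : ℝ)
    (x : Samp n q) {F : Samp n q' → ENNReal} (hF : Measurable F) :
    ∫⁻ y, F y ∂reduction n q q' hr R x =
      ∫⁻ k, ∫⁻ z, F (modq q' k, x.2 + ((z : ℝ) : 𝕋)) ∂contGauss (r * R)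
        ∂Measure.pi fun i => (roundPMF q' hr (x.1 i)).toMeasure := by
  have hm := measurable_reduction_map n q' x.2
  change ∫⁻ y, F y ∂Measure.map _ _ = _
  rw [lintegral_map hF hm]
  exact lintegral_prod _ (hF.comp hm).aemeasurable

lemma lintegral_pi_contGauss_sum_add {n : ℕ} {ρ σ γ : ℝ} (c : Fin n → ℝ)
    (h : γ ^ 2 = ρ ^ 2 * ∑ i, c i ^ 2 + σ ^ 2) {H : ℝ → ENNReal} (hH : Measurable H) :
    ∫⁻ g, ∫⁻ y, H (∑ i, c i * g i + y) ∂contGauss σ ∂(Measure.pi fun _ : Fin n => contGauss ρ) =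
      ∫⁻ z, H z ∂contGauss γ := by
  have hs : Measurable fun g : Fin n → ℝ => ∑ i, c i * g i :=
    Finset.measurable_sum _ fun i _ => by fun_prop
  have hγ : γ ^ 2 = (ρ * Real.sqrt (∑ i, c i ^ 2)) ^ 2 + σ ^ 2 := by
    rw [mul_pow, Real.sq_sqrt (Finset.sum_nonneg fun i _ => sq_nonneg _), h]
  have hH' : Measurable fun p : ℝ × ℝ => H (p.1 + p.2) := by fun_prop
  rw [← contGauss_conv hγ, lintegral_map hH (by fun_prop), lintegral_prod _ hH'.aemeasurable,
    ← pi_contGauss_map_sum, lintegral_map hH'.lintegral_prod_right' hs]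

lemma lintegral_pi_prod_split {α β : Type*} [MeasurableSpace α] [MeasurableSpace β] {n : ℕ}
    (μ : Fin n → Measure α) (ν : Fin n → Measure β) [∀ i, IsProbabilityMeasure (μ i)]
    [∀ i, IsProbabilityMeasure (ν i)] {H : (Fin n → α) × (Fin n → β) → ENNReal}
    (hH : Measurable H) :
    ∫⁻ ω, H (fun i => (ω i).1, fun i => (ω i).2) ∂(Measure.pi fun i => (μ i).prod (ν i)) =
      ∫⁻ x, ∫⁻ y, H (x, y) ∂Measure.pi ν ∂Measure.pi μ := by
  rw [← lintegral_prod _ hH.aemeasurable]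
  exact (measurePreserving_arrowProdEquivProdArrow α β (Fin n) μ ν).lintegral_comp hH

/-- `roundJoint` as a Markov kernel. -/
def roundKernel (q q' : ℕ) [NeZero q'] {r : ℝ} (hr : 0 < r) : Kernel (ZMod q) (ZMod q' × ℝ) :=
  ⟨roundJoint q' hr, measurable_from_top⟩

instance (q q' : ℕ) [NeZero q'] {r : ℝ} (hr : 0 < r) : IsMarkovKernel (roundKernel q q' hr) :=
  ⟨fun a => inferInstanceAs (IsProbabilityMeasure (roundJoint q' hr a))⟩

lemma inorm_sq {n : ℕ} (s : Fin n → ℤ) : inorm s ^ 2 = ∑ i, (s i : ℝ) ^ 2 :=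
  Real.sq_sqrt (Finset.sum_nonneg fun _ _ => sq_nonneg _)

lemma inorm_nonneg {n : ℕ} (s : Fin n → ℤ) : 0 ≤ inorm s := Real.sqrt_nonneg _

/-- The acceptance weight `F` of the reduced sample, as a function of the rounded vector, the
combined error of each coordinate, and the initial error. -/
def joinedWeight {n q' : ℕ} [NeZero q'] (s : Fin n → ℤ) (σ : ℝ) (F : Samp n q' → ENNReal)
    (x : 𝕋) (p : (Fin n → ZMod q') × (Fin n → ℝ)) : ENNReal :=
  ∫⁻ y, F (p.1, toT (∑ j, p.1 j * modq q' s j) + x + ((∑ i, -(s i : ℝ) * p.2 i + y : ℝ) : 𝕋))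
    ∂contGauss σ

lemma measurable_joinedWeight {n q' : ℕ} [NeZero q'] (s : Fin n → ℤ) (σ : ℝ)
    {F : Samp n q' → ENNReal} (hF : Measurable F) :
    Measurable fun p : 𝕋 × (Fin n → ZMod q') × (Fin n → ℝ) => joinedWeight s σ F p.1 p.2 := by
  have hs : Measurable fun g : Fin n → ℝ => ∑ i, -(s i : ℝ) * g i :=
    Finset.measurable_sum _ fun i _ => by fun_prop
  have h := measurable_toT_sum n q' (modq q' s)
  have hc := measurable_coe_torus
  refine Measurable.lintegral_prod_right' (f := fun w : (𝕋 × (Fin n → ZMod q') × (Fin n → ℝ)) × ℝ =>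
    F (w.1.2.1, toT (∑ j, w.1.2.1 j * modq q' s j) + w.1.1 +
      ((∑ i, -(s i : ℝ) * w.1.2.2 i + w.2 : ℝ) : 𝕋))) (hF.comp ?_)
  refine Measurable.prodMk (by fun_prop) (((h.comp ?_).add ?_).add (hc.comp ((hs.comp ?_).add ?_)))
  all_goals fun_prop

lemma lintegral_reduction_eq (n q q' : ℕ) [NeZero q] [NeZero q'] {r : ℝ} (hr : 0 < r) {R σ : ℝ}
    {s : Fin n → ℤ} (hσ : r ^ 2 * R ^ 2 = r ^ 2 * inorm s ^ 2 + σ ^ 2) (a : Fin n → ZMod q) (x : 𝕋)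
    {F : Samp n q' → ENNReal} (hF : Measurable F) :
    ∫⁻ y, F y ∂reduction n q q' hr R (a, toT (∑ j, a j * modq q s j) + x) =
      ∫⁻ ω, joinedWeight s σ F x (fun i => (ω i).1, fun i => (ω i).2)
        ∂samplewise n (roundKernel q q' hr) a := by
  have hW : Measurable (joinedWeight s σ F x) :=
    (measurable_joinedWeight s σ hF).comp measurable_prodMk_left
  have hr1 (i : Fin n) : Measurable fun p : ℤ × ℝ =>
      ((p.1 : ZMod q'), offset q' (a i) p.1 + p.2) := by
    unfold offset; fun_prop
  have hpi : samplewise n (roundKernel q q' hr) a =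
      (Measure.pi fun i => (roundPMF q' hr (a i)).toMeasure.prod (contGauss r)).map
        fun p i => (((p i).1 : ZMod q'), offset q' (a i) (p i).1 + (p i).2) := by
    have (i : Fin n) : SigmaFinite (((roundPMF q' hr (a i)).toMeasure.prod (contGauss r)).map
        fun p => ((p.1 : ZMod q'), offset q' (a i) p.1 + p.2)) :=
      inferInstanceAs (SigmaFinite (roundJoint q' hr (a i)))
    exact (Measure.pi_map_pi fun i => (hr1 i).aemeasurable).symm
  have hf1 : Measurable fun p : (Fin n → ℤ) × (Fin n → ℝ) =>
      (modq q' p.1, fun i => offset q' (a i) (p.1 i) + p.2 i) := by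
    refine ((measurable_modq n q').comp measurable_fst).prodMk ?_
    unfold offset
    fun_prop
  have hWp : Measurable fun ω : Fin n → ZMod q' × ℝ =>
      joinedWeight s σ F x (fun i => (ω i).1, fun i => (ω i).2) := hW.comp (by fun_prop)
  have hrp : Measurable fun (p : Fin n → ℤ × ℝ) (i : Fin n) =>
      (((p i).1 : ZMod q'), offset q' (a i) (p i).1 + (p i).2) :=
    measurable_pi_lambda _ fun i => (hr1 i).comp (measurable_pi_apply i)
  rw [hpi, lintegral_map hWp hrp, lintegral_reduction n q q' hr R _ hF]
  refine Eq.trans ?_ (lintegral_pi_prod_split _ _ (hW.comp hf1)).symm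
  refine lintegral_congr fun k => ?_
  have hFk (b : 𝕋) : Measurable fun z : ℝ => F (modq q' k, b + (z : 𝕋)) :=
    hF.comp (measurable_const.prodMk (measurable_coe_torus.const_add b))
  rw [← lintegral_pi_contGauss_sum_add (ρ := r) (σ := σ) (fun i => -(s i : ℝ))
    (by simp only [neg_sq]; rw [mul_pow, hσ, inorm_sq]) (hFk _)]
  refine lintegral_congr fun g => lintegral_congr fun y => ?_
  simp only
  congr 2
  rw [toT_sum_val, toT_sum_intCast, add_right_comm, add_right_comm _ x, ← AddCircle.coe_add,
    ← AddCircle.coe_add]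
  congr 2
  rw [← add_assoc, ← add_assoc, ← Finset.sum_add_distrib, ← Finset.sum_add_distrib]
  congr 1
  refine Finset.sum_congr rfl fun i _ => ?_
  rw [offset]
  ring

lemma smul_lweTorus_le_bind_reduction (n q q' : ℕ) [NeZero q] [NeZero q'] {r : ℝ} (hr : 0 < r)
    {c : ENNReal} (hc : c • (PMF.uniformOfFintype (ZMod q')).toMeasure.prod
        (contGauss (Real.sqrt 2 * r)) ≤
      (PMF.uniformOfFintype (ZMod q)).toMeasure.bind (roundJoint q' hr))
    {R : ℝ} {s : Fin n → ℤ} (hs : inorm s ≤ R) (ν : Measure 𝕋) [IsProbabilityMeasure ν] :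
    c ^ n • lweTorus n q' (modq q' s)
        ((ν.prod (contGauss (r * Real.sqrt (R ^ 2 + inorm s ^ 2)))).map
          fun p => p.1 + ((p.2 : ℝ) : 𝕋)) ≤
      (lweTorus n q (modq q s) ν).bind (reduction n q q' hr R) := by
  have hsR : inorm s ^ 2 ≤ R ^ 2 := pow_le_pow_left₀ (inorm_nonneg s) hs 2
  set σ : ℝ := r * Real.sqrt (R ^ 2 - inorm s ^ 2) with hσ
  have hσ2 : σ ^ 2 = r ^ 2 * (R ^ 2 - inorm s ^ 2) := by
    rw [hσ, mul_pow, Real.sq_sqrt (by linarith)]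
  have hadd : Measurable fun p : 𝕋 × ℝ => p.1 + (p.2 : 𝕋) :=
    measurable_fst.add (measurable_coe_torus.comp measurable_snd)
  have : IsProbabilityMeasure ((ν.prod (contGauss (r * Real.sqrt (R ^ 2 + inorm s ^ 2)))).map
      fun p => p.1 + ((p.2 : ℝ) : 𝕋)) := Measure.isProbabilityMeasure_map hadd.aemeasurable
  have hpi : c ^ n • (Measure.pi fun _ : Fin n => (PMF.uniformOfFintype (ZMod q')).toMeasure.prod
      (contGauss (Real.sqrt 2 * r))) ≤
      (PMF.uniformOfFintype (Fin n → ZMod q)).toMeasure.bind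
        (samplewise n (roundKernel q q' hr)) := by
    have hc' : c • (PMF.uniformOfFintype (ZMod q')).toMeasure.prod
        (contGauss (Real.sqrt 2 * r)) ≤
        (PMF.uniformOfFintype (ZMod q)).toMeasure.bind (roundKernel q q' hr) := hc
    rw [uniformOfFintype_pi, pi_bind_samplewise]
    have h := smul_pi_le_pi (ι := Fin n) (fun _ => hc')
    rwa [Fintype.card_fin] at h
  suffices H : ∀ F : Samp n q' → ENNReal, Measurable F →
      c ^ n * ∫⁻ x, F x ∂lweTorus n q' (modq q' s)
        ((ν.prod (contGauss (r * Real.sqrt (R ^ 2 + inorm s ^ 2)))).map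
          fun p => p.1 + ((p.2 : ℝ) : 𝕋)) ≤
      ∫⁻ x, F x ∂(lweTorus n q (modq q s) ν).bind (reduction n q q' hr R) by
    refine Measure.le_intro fun t ht _ => ?_
    simpa [lintegral_indicator_one ht] using H (t.indicator 1) (measurable_one.indicator ht)
  intro F hF
  have hW (x : 𝕋) : Measurable (joinedWeight s σ F x) :=
    (measurable_joinedWeight s σ hF).comp measurable_prodMk_left
  have hproj : Measurable fun ω : Fin n → ZMod q' × ℝ => (fun i => (ω i).1, fun i => (ω i).2) := by
    fun_prop
  calc _ = ∫⁻ x, c ^ n * ∫⁻ ω, joinedWeight s σ F x (fun i => (ω i).1, fun i => (ω i).2)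
          ∂(Measure.pi fun _ : Fin n => (PMF.uniformOfFintype (ZMod q')).toMeasure.prod
            (contGauss (Real.sqrt 2 * r))) ∂ν := by
        have hm1 : Measurable fun t : 𝕋 => ∫⁻ a, F (a, toT (∑ j, a j * modq q' s j) + t)
            ∂(PMF.uniformOfFintype (Fin n → ZMod q')).toMeasure :=
          Measurable.lintegral_prod_left' (hF.comp (measurable_lweTorus_map n q' (modq q' s)))
        have hm1c : Measurable fun p : 𝕋 × ℝ => ∫⁻ a,
            F (a, toT (∑ j, a j * modq q' s j) + (p.1 + (p.2 : 𝕋)))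
            ∂(PMF.uniformOfFintype (Fin n → ZMod q')).toMeasure := hm1.comp hadd
        rw [lintegral_lweTorus _ _ _ _ hF, lintegral_map hm1 hadd,
          lintegral_prod _ hm1c.aemeasurable, ← lintegral_const_mul _ hm1c.lintegral_prod_right']
        refine lintegral_congr fun x => ?_
        rw [lintegral_pi_prod_split _ _ (hW x), ← uniformOfFintype_pi]
        have hm2 : Measurable fun p : ℝ × (Fin n → ZMod q') =>
            F (p.2, toT (∑ j, p.2 j * modq q' s j) + (x + (p.1 : 𝕋))) :=
          (hF.comp (measurable_lweTorus_map n q' (modq q' s))).comp (measurable_snd.prodMk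
            ((measurable_coe_torus.comp measurable_fst).const_add x))
        rw [lintegral_lintegral_swap hm2.aemeasurable]
        congr 1
        refine lintegral_congr fun a => ?_
        have hγ : (r * Real.sqrt (R ^ 2 + inorm s ^ 2)) ^ 2 =
            (Real.sqrt 2 * r) ^ 2 * ∑ i, (-(s i : ℝ)) ^ 2 + σ ^ 2 := by
          simp only [neg_sq]
          rw [← inorm_sq, hσ2, mul_pow, mul_pow, Real.sq_sqrt (by positivity),
            Real.sq_sqrt (by positivity)]
          ring
        have hm2a : Measurable fun z : ℝ =>
            F (a, toT (∑ j, a j * modq q' s j) + (x + (z : 𝕋))) := hm2.comp measurable_prodMk_right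
        refine (lintegral_pi_contGauss_sum_add (fun i => -(s i : ℝ)) hγ hm2a).symm.trans ?_
        simp only [joinedWeight, add_assoc]
    _ ≤ ∫⁻ x, ∫⁻ ω, joinedWeight s σ F x (fun i => (ω i).1, fun i => (ω i).2)
          ∂(PMF.uniformOfFintype (Fin n → ZMod q)).toMeasure.bind
            (samplewise n (roundKernel q q' hr)) ∂ν := by
        refine lintegral_mono fun x => ?_
        rw [← smul_eq_mul, ← lintegral_smul_measure]
        exact lintegral_mono' hpi le_rfl
    _ = _ := by
        rw [Measure.lintegral_bind (reduction n q q' hr R).aemeasurable hF.aemeasurable,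
          lintegral_lweTorus _ _ _ _ hF.lintegral_kernel]
        refine lintegral_congr fun x => ?_
        refine (Measure.lintegral_bind (measurable_samplewise _ _).aemeasurable
          ((hW x).comp hproj).aemeasurable).trans ?_
        exact lintegral_congr fun a =>
          (lintegral_reduction_eq n q q' hr (by rw [hσ2]; ring) a x hF).symm

instance : IsProbabilityMeasure uniT := ⟨UnitAddCircle.measure_univ⟩

instance (n q : ℕ) [NeZero q] : IsProbabilityMeasure (uniSamp n q) := by
  unfold uniSamp; infer_instance

instance (n m q : ℕ) [NeZero q] : IsProbabilityMeasure (uniSamples n m q) := by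
  unfold uniSamples; infer_instance

lemma lweA_eq_lweTorus (n q : ℕ) [NeZero q] (s : Fin n → ZMod q) (φ : Measure ℝ)
    [IsProbabilityMeasure φ] : lweA n q s φ = lweTorus n q s (φ.map fun x : ℝ => (x : 𝕋)) := by
  have h := Measure.map_prod_map (PMF.uniformOfFintype (Fin n → ZMod q)).toMeasure φ
    measurable_id measurable_coe_torus
  rw [Measure.map_id] at h
  rw [lweTorus, h, Measure.map_map (measurable_lweTorus_map n q s)
    (measurable_id.prodMap measurable_coe_torus)]
  rfl

instance (n q : ℕ) [NeZero q] (s : Fin n → ZMod q) (φ : Measure ℝ) [IsProbabilityMeasure φ] :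
    IsProbabilityMeasure (lweA n q s φ) := by
  have : IsProbabilityMeasure (φ.map fun x : ℝ => (x : 𝕋)) :=
    Measure.isProbabilityMeasure_map measurable_coe_torus.aemeasurable
  rw [lweA_eq_lweTorus]; infer_instance

instance (n m q : ℕ) [NeZero q] (s : Fin n → ZMod q) (φ : Measure ℝ) [IsProbabilityMeasure φ] :
    IsProbabilityMeasure (lweSamples n m q s φ) := by
  unfold lweSamples; infer_instance

lemma uniSamp_eq_lweTorus (n q : ℕ) [NeZero q] : uniSamp n q = lweTorus n q 0 uniT := by
  simp [lweTorus, uniSamp, toT]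

lemma uniT_add_map (ρ : Measure ℝ) [IsProbabilityMeasure ρ] :
    ((uniT.prod ρ).map fun p => p.1 + ((p.2 : ℝ) : 𝕋)) = uniT := by
  have hadd : Measurable fun p : 𝕋 × ℝ => p.1 + (p.2 : 𝕋) :=
    measurable_fst.add (measurable_coe_torus.comp measurable_snd)
  refine Measure.ext_of_lintegral _ fun F hF => ?_
  have hF' : Measurable fun p : 𝕋 × ℝ => F (p.1 + (p.2 : 𝕋)) := hF.comp hadd
  rw [lintegral_map hF hadd, lintegral_prod_symm _ hF'.aemeasurable]
  simp only [uniT, lintegral_add_right_eq_self, lintegral_const, measure_univ, mul_one]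

lemma smul_lweA_le_bind_reduction (n q q' : ℕ) [NeZero q] [NeZero q'] {r : ℝ} (hr : 0 < r)
    {c : ENNReal} (hc : c • (PMF.uniformOfFintype (ZMod q')).toMeasure.prod
        (contGauss (Real.sqrt 2 * r)) ≤
      (PMF.uniformOfFintype (ZMod q)).toMeasure.bind (roundJoint q' hr))
    {R α β : ℝ} {s : Fin n → ℤ} (hs : inorm s ≤ R)
    (hβ : β ^ 2 = α ^ 2 + r ^ 2 * (R ^ 2 + inorm s ^ 2)) :
    c ^ n • lweA n q' (modq q' s) (contGauss β) ≤
      (lweA n q (modq q s) (contGauss α)).bind (reduction n q q' hr R) := by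
  have hp : IsProbabilityMeasure ((contGauss α).map fun x : ℝ => (x : 𝕋)) :=
    Measure.isProbabilityMeasure_map measurable_coe_torus.aemeasurable
  have hγ : β ^ 2 = α ^ 2 + (r * Real.sqrt (R ^ 2 + inorm s ^ 2)) ^ 2 := by
    rw [hβ, mul_pow, Real.sq_sqrt (by positivity)]
  have h := smul_lweTorus_le_bind_reduction n q q' hr hc hs ((contGauss α).map fun x : ℝ => (x : 𝕋))
  have hprod := Measure.map_prod_map (contGauss α)
    (contGauss (r * Real.sqrt (R ^ 2 + inorm s ^ 2))) measurable_coe_torus measurable_id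
  rw [Measure.map_id] at hprod
  have hadd : Measurable fun p : 𝕋 × ℝ => p.1 + (p.2 : 𝕋) :=
    measurable_fst.add (measurable_coe_torus.comp measurable_snd)
  rw [lweA_eq_lweTorus, lweA_eq_lweTorus, ← contGauss_conv hγ,
    Measure.map_map measurable_coe_torus (by fun_prop)]
  rw [hprod, Measure.map_map hadd (measurable_coe_torus.prodMap measurable_id)] at h
  exact h

lemma smul_uniSamp_le_bind_reduction (n q q' : ℕ) [NeZero q] [NeZero q'] {r : ℝ} (hr : 0 < r)
    {c : ENNReal} (hc : c • (PMF.uniformOfFintype (ZMod q')).toMeasure.prod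
        (contGauss (Real.sqrt 2 * r)) ≤
      (PMF.uniformOfFintype (ZMod q)).toMeasure.bind (roundJoint q' hr))
    {R : ℝ} (hR : 0 ≤ R) :
    c ^ n • uniSamp n q' ≤ (uniSamp n q).bind (reduction n q q' hr R) := by
  have h := smul_lweTorus_le_bind_reduction n q q' hr hc (s := 0) (R := R)
    (by simpa [inorm] using hR) uniT
  have hz (q : ℕ) : modq (n := n) q 0 = 0 := by ext; simp [modq]
  rwa [uniT_add_map, hz, hz, ← uniSamp_eq_lweTorus, ← uniSamp_eq_lweTorus] at h

lemma smul_pi_le_bind_samplewise {S S' : Type*} [MeasurableSpace S] [MeasurableSpace S'] (m : ℕ)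
    {κ : Kernel S S'} [IsMarkovKernel κ] {μ : Measure S} [IsProbabilityMeasure μ]
    {ν : Measure S'} [IsProbabilityMeasure ν] {c : ENNReal} (h : c • ν ≤ μ.bind κ) :
    c ^ m • (Measure.pi fun _ : Fin m => ν) ≤
      (Measure.pi fun _ : Fin m => μ).bind (samplewise m κ) := by
  rw [pi_bind_samplewise]
  simpa using smul_pi_le_pi (ι := Fin m) fun _ => h

lemma integrable_of_isDistinguisher {X : Type*} [MeasurableSpace X] {f : X → ℝ}
    (hf : IsDistinguisher f) (μ : Measure X) [IsFiniteMeasure μ] : Integrable f μ :=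
  .of_bound hf.1.aestronglyMeasurable 1 (.of_forall fun x => by
    rw [Real.norm_of_nonneg (hf.2 x).1]; exact (hf.2 x).2)

lemma integral_mem_Icc_of_isDistinguisher {X : Type*} [MeasurableSpace X] {f : X → ℝ}
    (hf : IsDistinguisher f) (μ : Measure X) [IsProbabilityMeasure μ] :
    ∫ x, f x ∂μ ∈ Set.Icc (0 : ℝ) 1 := by
  refine ⟨integral_nonneg fun x => (hf.2 x).1, ?_⟩
  simpa using integral_mono (integrable_of_isDistinguisher hf μ) (integrable_const (1 : ℝ))
    fun x => (hf.2 x).2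

lemma abs_integral_sub_le_one {X : Type*} [MeasurableSpace X] {f : X → ℝ}
    (hf : IsDistinguisher f) (μ ν : Measure X) [IsProbabilityMeasure μ] [IsProbabilityMeasure ν] :
    |(∫ x, f x ∂μ) - ∫ x, f x ∂ν| ≤ 1 := by
  have h1 := integral_mem_Icc_of_isDistinguisher hf μ
  have h2 := integral_mem_Icc_of_isDistinguisher hf ν
  exact abs_le.2 ⟨by linarith [h1.1, h2.2], by linarith [h1.2, h2.1]⟩

lemma abs_integral_sub_le_of_smul_le {X : Type*} [MeasurableSpace X] {μ ν : Measure X}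
    [IsProbabilityMeasure μ] [IsProbabilityMeasure ν] {t : ℝ} (ht : 0 ≤ t)
    (h : ENNReal.ofReal (1 - t) • ν ≤ μ) {f : X → ℝ} (hf : IsDistinguisher f) :
    |(∫ x, f x ∂μ) - ∫ x, f x ∂ν| ≤ t := by
  rcases le_total 1 t with ht1 | ht1
  · exact (abs_integral_sub_le_one hf μ ν).trans ht1
  have key {g : X → ℝ} (hg : IsDistinguisher g) : ∫ x, g x ∂ν - t ≤ ∫ x, g x ∂μ := by
    have h1 := integral_mono_measure h (.of_forall fun x => (hg.2 x).1)
      (integrable_of_isDistinguisher hg μ)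
    rw [integral_smul_measure, ENNReal.toReal_ofReal (by linarith), smul_eq_mul] at h1
    nlinarith [(integral_mem_Icc_of_isDistinguisher hg ν).2]
  have h1 := key hf
  have h2 := key (g := fun x => 1 - f x) ⟨hf.1.const_sub 1, fun x =>
    ⟨by linarith [(hf.2 x).2], by linarith [(hf.2 x).1]⟩⟩
  rw [integral_sub (integrable_const _) (integrable_of_isDistinguisher hf _),
    integral_sub (integrable_const _) (integrable_of_isDistinguisher hf _)] at h2
  simp only [integral_const, probReal_univ, smul_eq_mul, mul_one] at h2
  exact abs_le.2 ⟨by linarith, by linarith⟩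

lemma integral_bind_of_isDistinguisher {S X : Type*} [MeasurableSpace S] [MeasurableSpace X]
    (m : Measure S) {μ : S → Measure X} (hμ : Measurable μ)
    [∀ s, IsProbabilityMeasure (μ s)] {f : X → ℝ} (hf : IsDistinguisher f) :
    ∫ x, f x ∂m.bind μ = ∫ s, ∫ x, f x ∂μ s ∂m := by
  have hf0 (ρ : Measure X) : 0 ≤ᵐ[ρ] f := .of_forall fun x => (hf.2 x).1
  have hof : Measurable fun x => ENNReal.ofReal (f x) := hf.1.ennreal_ofReal
  have hin (s : S) : ∫ x, f x ∂μ s = (∫⁻ x, ENNReal.ofReal (f x) ∂μ s).toReal :=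
    integral_eq_lintegral_of_nonneg_ae (hf0 _) hf.1.aestronglyMeasurable
  rw [integral_eq_lintegral_of_nonneg_ae (hf0 _) hf.1.aestronglyMeasurable,
    Measure.lintegral_bind hμ.aemeasurable hof.aemeasurable]
  simp_rw [hin]
  refine (integral_toReal ((Measure.measurable_lintegral hof).comp hμ).aemeasurable
    (.of_forall fun s => ?_)).symm
  rw [Function.comp_apply,
    ← ofReal_integral_eq_lintegral_ofReal (integrable_of_isDistinguisher hf _) (hf0 _)]
  exact ENNReal.ofReal_lt_top

lemma abs_integral_bind_sub_le {S X : Type*} [MeasurableSpace S] [DiscreteMeasurableSpace S]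
    [MeasurableSpace X] (m : Measure S) [IsProbabilityMeasure m] {μ ν : S → Measure X}
    [∀ s, IsProbabilityMeasure (μ s)] [∀ s, IsProbabilityMeasure (ν s)] {t : ℝ} (ht : 0 ≤ t)
    {B : Set S} (h : ∀ s ∉ B, ENNReal.ofReal (1 - t) • ν s ≤ μ s) {f : X → ℝ}
    (hf : IsDistinguisher f) :
    |(∫ x, f x ∂m.bind μ) - ∫ x, f x ∂m.bind ν| ≤ t + m.real B := by
  have hint (ρ : S → Measure X) [∀ s, IsProbabilityMeasure (ρ s)] :
      Integrable (fun s => ∫ x, f x ∂ρ s) m :=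
    integrable_of_isDistinguisher ⟨.of_discrete, fun s =>
      integral_mem_Icc_of_isDistinguisher hf (ρ s)⟩ m
  have hB : Integrable (B.indicator (1 : S → ℝ)) m :=
    (integrable_const (1 : ℝ)).indicator .of_discrete
  rw [integral_bind_of_isDistinguisher m .of_discrete hf,
    integral_bind_of_isDistinguisher m .of_discrete hf, ← integral_sub (hint μ) (hint ν)]
  refine abs_integral_le_integral_abs.trans ?_
  calc _ ≤ ∫ s, (t + B.indicator 1 s) ∂m := by
        refine integral_mono ((hint μ).sub (hint ν)).abs ((integrable_const t).add hB) fun s => ?_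
        by_cases hs : s ∈ B
        · simpa [hs] using (abs_integral_sub_le_one hf (μ s) (ν s)).trans (by linarith)
        · simpa [hs] using abs_integral_sub_le_of_smul_le ht (h s hs) hf
    _ = _ := by
        rw [integral_add (integrable_const t) hB, integral_indicator_one .of_discrete]
        simp

/-- For a sufficiently large width `w`, the sum of the Gaussian of width `w` over any shift of `ℤ`
equals `w` up to a relative error `η`. -/
lemma abs_theta_sub_le {w η y : ℝ} (hw : 0 < w) (hy : 1 < y) (hlog : Real.log y ≤ Real.pi * w ^ 2)
    (hη : 2 ≤ η * (y - 1)) (c : ℝ) :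
    |∑' n : ℤ, Real.exp (-Real.pi * (n + c) ^ 2 / w ^ 2) - w| ≤ w * η := by
  refine (theta_bound hw c).2.trans ?_
  set x := Real.exp (-Real.pi * w ^ 2) with hx
  have hy0 : 0 < y := by linarith
  have hx0 : 0 < x := Real.exp_pos _
  have hxy : x * y ≤ 1 := by
    rw [← Real.exp_log hy0, hx, ← Real.exp_add, Real.exp_le_one_iff]
    linarith
  have hx1 : x < 1 := by nlinarith
  have hη0 : 0 < η := by nlinarith
  gcongr
  rw [div_le_iff₀ (by linarith)]
  nlinarith [mul_le_mul_of_nonneg_left hη hx0.le, mul_le_mul_of_nonneg_left hxy hη0.le]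

lemma one_sub_mul_le_pow {ε : ℝ} (n : ℕ) (hε : ε ≤ 2) :
    1 - n * ε ≤ (1 - ε) ^ n := by
  have := one_add_mul_le_pow (a := -ε) (by linarith) n
  rw [← sub_eq_add_neg] at this
  linarith

lemma smul_le_bind_roundJoint_of_log {n q q' : ℕ} [NeZero q] [NeZero q'] (hn : 1 ≤ n)
    (hqq' : q' ≤ q) {ε r : ℝ} (hε : 0 < ε) (hε' : ε < 1 / 2) (hr : 0 < r)
    (hr2 : Real.pi * (r * q') ^ 2 = 2 * Real.log (2 * n * (1 + 1 / ε))) :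
    ENNReal.ofReal ((1 - ε / n) / (1 + ε / n)) •
      (PMF.uniformOfFintype (ZMod q')).toMeasure.prod (contGauss (Real.sqrt 2 * r)) ≤
    (PMF.uniformOfFintype (ZMod q)).toMeasure.bind (roundJoint q' hr) := by
  have hq : (0 : ℝ) < q := by exact_mod_cast NeZero.pos q
  have hq' : (0 : ℝ) < q' := by exact_mod_cast NeZero.pos q'
  have hn' : (1 : ℝ) ≤ n := by exact_mod_cast hn
  have hle : (q' : ℝ) ≤ q := by exact_mod_cast hqq'
  have hη : ε / n * n = ε := by field_simp
  have hη0 : 0 < ε / n := by positivity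
  have hy1 : 1 < 2 * n * (1 + 1 / ε) := by
    have : 0 < 1 / ε := by positivity
    nlinarith
  have hy2 : 2 ≤ ε / n * (2 * n * (1 + 1 / ε) - 1) := by
    have : ε / n * (2 * n * (1 + 1 / ε) - 1) = 2 + (2 * ε - ε / n) := by field_simp; ring
    have : ε / n ≤ ε := div_le_self hε.le hn'
    linarith
  have hL := Real.log_pos hy1
  refine smul_le_bind_roundJoint q q' hr hη0 ?_ (fun c => ?_) fun c => ?_
  · linarith [div_le_self hε.le hn']
  · have h := abs_theta_sub_le (mul_pos hr hq') hy1 (by linarith) hy2 c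
    linarith [(abs_le.1 h).2]
  · have h := abs_theta_sub_le (w := r * q / Real.sqrt 2) (by positivity) hy1 ?_ hy2 c
    · linarith [(abs_le.1 h).1]
    · have : (r * q') ^ 2 ≤ (r * q) ^ 2 := by gcongr
      rw [div_pow, Real.sq_sqrt (by norm_num)]
      nlinarith [Real.pi_pos]

lemma ofReal_one_sub_le_pow {n : ℕ} (m : ℕ) (hn : 1 ≤ n) {ε : ℝ} (hε : 0 < ε) (hε' : ε < 1 / 2) :
    ENNReal.ofReal (1 - 2 * ε * m) ≤ (ENNReal.ofReal ((1 - ε / n) / (1 + ε / n)) ^ n) ^ m := by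
  have hn' : (1 : ℝ) ≤ n := by exact_mod_cast hn
  have hη0 : 0 < ε / n := by positivity
  have hη1 : ε / n ≤ 1 / 2 := by linarith [div_le_self hε.le hn']
  have hc : 1 - 2 * (ε / n) ≤ (1 - ε / n) / (1 + ε / n) := by
    rw [le_div_iff₀ (by linarith)]
    nlinarith
  have h := one_sub_mul_le_pow (ε := 2 * (ε / n)) (n * m) (by linarith)
  have he : ((n * m : ℕ) : ℝ) * (2 * (ε / n)) = 2 * ε * m := by
    push_cast
    field_simp
  rw [he] at h
  rw [← pow_mul, ← ENNReal.ofReal_pow (div_nonneg (by linarith) (by linarith))]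
  exact ENNReal.ofReal_le_ofReal (h.trans (pow_le_pow_left₀ (by linarith) hc _))

lemma adv_sub_le {X : Type*} [MeasurableSpace X] (f : X → ℝ) {P₀ P₁ Q₀ Q₁ : Measure X} {a b : ℝ}
    (h₀ : |(∫ x, f x ∂Q₀) - ∫ x, f x ∂P₀| ≤ a) (h₁ : |(∫ x, f x ∂Q₁) - ∫ x, f x ∂P₁| ≤ b) :
    adv f P₀ P₁ - (a + b) ≤ adv f Q₀ Q₁ := by
  unfold adv
  set p₀ := ∫ x, f x ∂P₀
  set p₁ := ∫ x, f x ∂P₁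
  set q₀ := ∫ x, f x ∂Q₀
  set q₁ := ∫ x, f x ∂Q₁
  have h := abs_sub_abs_le_abs_sub (p₀ - p₁) (q₀ - q₁)
  have h' : |p₀ - p₁ - (q₀ - q₁)| ≤ |q₀ - p₀| + |q₁ - p₁| := by
    rw [show p₀ - p₁ - (q₀ - q₁) = (q₁ - p₁) - (q₀ - p₀) by ring]
    linarith [abs_sub (q₁ - p₁) (q₀ - p₀)]
  linarith

/-- **Corollary 3.2 (modulus reduction).** For any `m, n ≥ 1`, `q ≥ q' ≥ 1`, any
`(R,δ)`-bounded distribution `𝒟` over `ℤⁿ`, and any `α, β > 0`, `ε ∈ (0,1/2)` with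
`β² ≥ α² + (4/π)·ln(2n(1+1/ε))·(R/q')²`, there is a randomized map
`T : T_qⁿ × 𝕋 → T_{q'}ⁿ × 𝕋` (a Markov kernel), applied independently to each of the `m`
samples, such that for every noise level `α(s) ≤ α` there are noise levels `β'(s) ≤ β`
(arising from the reduction) so that every distinguisher `f` between `m` samples of
`A_{q',s,D_{β'(s)}}` (with `s ← 𝒟`) and `m` uniform samples, with advantage `ζ`, yields —
by composing `f` with the samplewise application of `T` — a distinguisher between `m`
samples of `A_{q,s,D_{α(s)}}` (with `s ← 𝒟`) and `m` uniform samples, with advantage at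
least `ζ − δ − 14εm`. -/
theorem modulus_reduction (m n q q' : ℕ) [NeZero q] [NeZero q']
    (hm : 1 ≤ m) (hn : 1 ≤ n) (hq' : 1 ≤ q') (hqq' : q' ≤ q)
    (𝒟 : PMF (Fin n → ℤ)) (R δ : ℝ) (h𝒟 : IsBounded 𝒟 R δ)
    (α β ε : ℝ) (hα : 0 < α) (hβ : 0 < β) (hε : 0 < ε) (hε' : ε < 1 / 2)
    (hnoise : α ^ 2 + (4 / Real.pi) * Real.log (2 * n * (1 + 1 / ε)) * (R / q') ^ 2 ≤ β ^ 2) :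
    ∃ κ : Kernel (Samp n q) (Samp n q'), IsMarkovKernel κ ∧
      ∀ αf : (Fin n → ℤ) → ℝ, (∀ s, 0 ≤ αf s ∧ αf s ≤ α) →
      ∃ βf : (Fin n → ℤ) → ℝ, (∀ s, 0 ≤ βf s ∧ βf s ≤ β) ∧
      ∀ f : (Fin m → Samp n q') → ℝ, IsDistinguisher f →
        adv f (𝒟.toMeasure.bind fun s => lweSamples n m q' (modq q' s) (contGauss (βf s)))
            (uniSamples n m q')
          - δ - 14 * ε * m
        ≤ adv f
            ((𝒟.toMeasure.bind fun s =>
                lweSamples n m q (modq q s) (contGauss (αf s))).bind (samplewise m κ))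
            ((uniSamples n m q).bind (samplewise m κ)) := by
  have hq'0 : (0 : ℝ) < q' := by exact_mod_cast NeZero.pos q'
  have hn' : (1 : ℝ) ≤ n := by exact_mod_cast hn
  have hL : 0 < Real.log (2 * n * (1 + 1 / ε)) := by
    refine Real.log_pos ?_
    have : 0 < 1 / ε := by positivity
    nlinarith
  set L := Real.log (2 * n * (1 + 1 / ε)) with hLdef
  have hr : 0 < Real.sqrt (2 / Real.pi * L) / q' := by positivity
  set r := Real.sqrt (2 / Real.pi * L) / q' with hrdef
  have hr2 : r ^ 2 = 2 / Real.pi * L / q' ^ 2 := by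
    rw [hrdef, div_pow, Real.sq_sqrt (by positivity)]
  have hc := smul_le_bind_roundJoint_of_log hn hqq' hε hε' hr
    (by rw [mul_pow, hr2, ← hLdef]; field_simp)
  refine ⟨reduction n q q' hr R, inferInstance, fun αf hαf => ?_⟩
  have : ∀ s, IsProbabilityMeasure ((lweSamples n m q (modq q s) (contGauss (αf s))).bind
      (samplewise m (reduction n q q' hr R))) := fun s => by
    rw [lweSamples, pi_bind_samplewise]; infer_instance
  have : IsProbabilityMeasure ((uniSamples n m q).bind
      (samplewise m (reduction n q q' hr R))) := by
    rw [uniSamples, pi_bind_samplewise]; infer_instance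
  rw [IsBounded] at h𝒟
  have hbind : (𝒟.toMeasure.bind fun s => lweSamples n m q (modq q s) (contGauss (αf s))).bind
      (samplewise m (reduction n q q' hr R)) =
      𝒟.toMeasure.bind fun s => (lweSamples n m q (modq q s) (contGauss (αf s))).bind
        (samplewise m (reduction n q q' hr R)) :=
    Measure.bind_bind Measurable.of_discrete.aemeasurable
      (measurable_samplewise m _).aemeasurable
  rw [hbind]
  set βf : (Fin n → ℤ) → ℝ := fun s =>
    if inorm s ≤ R then Real.sqrt (αf s ^ 2 + r ^ 2 * (R ^ 2 + inorm s ^ 2)) else 0 with hβf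
  refine ⟨βf, fun s => ?_, fun f hf => ?_⟩
  · by_cases hs : inorm s ≤ R
    · simp only [hβf, hs, if_true]
      refine ⟨Real.sqrt_nonneg _, Real.sqrt_le_iff.2 ⟨hβ.le, le_trans ?_ hnoise⟩⟩
      have h1 : αf s ^ 2 ≤ α ^ 2 := pow_le_pow_left₀ (hαf s).1 (hαf s).2 2
      have h2 : inorm s ^ 2 ≤ R ^ 2 := pow_le_pow_left₀ (inorm_nonneg s) hs 2
      have h3 : 4 / Real.pi * L * (R / q') ^ 2 = r ^ 2 * (R ^ 2 + R ^ 2) := by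
        rw [hr2]; ring
      rw [h3]
      gcongr
    · simp [hβf, hs, hβ.le]
  have ht : 0 ≤ 2 * ε * m := by positivity
  have hsm {X : Type} [MeasurableSpace X] {μ ν : Measure X}
      (h : (ENNReal.ofReal ((1 - ε / n) / (1 + ε / n)) ^ n) ^ m • ν ≤ μ) :
      ENNReal.ofReal (1 - 2 * ε * m) • ν ≤ μ :=
    (Measure.le_intro fun t _ _ => by
      simp only [Measure.smul_apply, smul_eq_mul]
      gcongr
      exact ofReal_one_sub_le_pow m hn hε hε').trans h
  have h₀ := abs_integral_bind_sub_le 𝒟.toMeasure ht (B := {s | R < inorm s})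
    (μ := fun s => (lweSamples n m q (modq q s) (contGauss (αf s))).bind
      (samplewise m (reduction n q q' hr R)))
    (ν := fun s => lweSamples n m q' (modq q' s) (contGauss (βf s))) (fun s hs => hsm ?_) hf
  swap
  · have hs : inorm s ≤ R := not_lt.1 hs
    refine smul_pi_le_bind_samplewise m (smul_lweA_le_bind_reduction n q q' hr hc hs ?_)
    simp only [hβf, hs, if_true]
    exact Real.sq_sqrt (by positivity)
  rcases le_or_gt 0 R with hR | hR
  · have h₁ := abs_integral_sub_le_of_smul_le (μ := (uniSamples n m q).bind
      (samplewise m (reduction n q q' hr R))) (ν := uniSamples n m q') ht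
      (hsm (smul_pi_le_bind_samplewise m (smul_uniSamp_le_bind_reduction n q q' hr hc hR))) hf
    have h := adv_sub_le f h₀ h₁
    have hreal : 𝒟.toMeasure.real {s | R < inorm s} ≤ δ := h𝒟
    have : 0 ≤ ε * m := by positivity
    linarith
  · have huniv : {s : Fin n → ℤ | R < inorm s} = Set.univ :=
      Set.eq_univ_of_forall fun s => hR.trans_le (inorm_nonneg s)
    rw [huniv, measure_univ, ENNReal.toReal_one] at h𝒟
    have : IsProbabilityMeasure (𝒟.toMeasure.bind fun s =>
        lweSamples n m q' (modq q' s) (contGauss (βf s))) :=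
      isProbabilityMeasure_bind Measurable.of_discrete.aemeasurable
        (.of_forall fun s => inferInstance)
    have h := abs_integral_sub_le_one hf (𝒟.toMeasure.bind fun s =>
        lweSamples n m q' (modq q' s) (contGauss (βf s))) (uniSamples n m q')
    have : 0 ≤ ε * m := by positivity
    refine le_trans ?_ (abs_nonneg _)
    rw [adv]
    linarith

end LWEPaper
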